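/- There exists a holey packing quadruple system HPQS(47,11) having exactly J(47,4,4) − J(11,4,4) = 3959 − 35 = 3924 blocks. -/

import Mathlib

/-- A 3-(n,4,1) packing design (packing quadruple system PQS(n)) on the point
set `Fin n`: a collection of 4-element blocks such that every 3-element subset
of points is contained in at most one block. -/
def IsPQS (n : ℕ) (B : Finset (Finset (Fin n))) : Prop :=
  (∀ b ∈ B, b.card = 4) ∧
  ∀ t : Finset (Fin n), t.card = 3 → (B.filter (fun b => t ⊆ b)).card ≤ 1

/-- The packing number A(n,4,4): the maximum number of blocks in a
3-(n,4,1) packing design. -/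
noncomputable def packingNumber (n : ℕ) : ℕ :=
  sSup {N | ∃ B : Finset (Finset (Fin n)), IsPQS n B ∧ B.card = N}

/-- The Johnson bound J(n,4,4). -/
def johnsonBound (n : ℕ) : ℕ :=
  if n % 6 = 0 then n * ((n - 1) * ((n - 2) / 2) / 3) / 4 - 1
  else n * ((n - 1) * ((n - 2) / 2) / 3) / 4

/-- There exists a holey packing quadruple system HPQS(n,m) with exactly `N`
blocks: a PQS(n) together with an m-element hole `Y` such that no 3-element
subset of `Y` is contained in any block. -/
def ExistsHPQS (n m N : ℕ) : Prop :=
  ∃ (B : Finset (Finset (Fin n))) (Y : Finset (Fin n)),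
    IsPQS n B ∧ Y.card = m ∧
    (∀ t : Finset (Fin n), t ⊆ Y → t.card = 3 → ∀ b ∈ B, ¬ t ⊆ b) ∧
    B.card = N

namespace HPQS

/-- The image of a block under the map sending `i` to the `i`-th entry of `p`. -/
def permute (p b : List ℕ) : List ℕ := b.map (p.getD · 0)

/-- An automorphism of order 12: a rotation of each of seven intervals of points. -/
def rotation : List ℕ :=
  [1, 2, 3, 4, 5, 6, 7, 8, 9, 10, 11, 0, 13, 14, 15, 16, 17, 18, 19, 20, 21, 22, 23, 12, 25, 26,
   27, 28, 29, 24, 31, 32, 33, 34, 35, 30, 37, 38, 39, 36, 41, 42, 43, 40, 45, 46, 44]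

/-- An automorphism of order 3. -/
def trisection : List ℕ :=
  [12, 29, 14, 32, 16, 27, 18, 30, 20, 25, 22, 34, 26, 3, 35, 5, 24, 7, 33, 9, 28, 11, 31, 1, 4,
   19, 0, 15, 8, 23, 17, 10, 13, 6, 21, 2, 38, 36, 37, 39, 43, 40, 42, 41, 45, 46, 44]

/-- An automorphism of order 2. -/
def reflection : List ℕ :=
  [34, 18, 29, 20, 32, 22, 27, 12, 30, 14, 25, 16, 7, 26, 9, 35, 11, 24, 1, 33, 3, 28, 5, 31,
   17, 10, 13, 6, 21, 2, 8, 23, 4, 19, 0, 15, 37, 36, 38, 39, 43, 41, 42, 40, 44, 45, 46]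

/-- The images of `b` under `reflection ^ k * trisection ^ j * rotation ^ i` with `i < l`, `j < m`
and `k < n`. -/
def images (l m n : ℕ) (b : List ℕ) : List (List ℕ) :=
  (List.iterate (permute rotation) b l).flatMap fun c =>
    (List.iterate (permute trisection) c m).flatMap fun d =>
      List.iterate (permute reflection) d n

/-- Representatives of the orbits of blocks, grouped by the numbers of powers of `rotation`,
`trisection` and `reflection` that are to be applied to them. -/
def baseBlocks : List (ℕ × ℕ × ℕ × List (List ℕ)) :=
  [(12, 3, 2, [[0, 1, 2, 39], [0, 1, 3, 4], [0, 1, 5, 21], [0, 1, 12, 41], [0, 1, 13, 40],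
     [0, 1, 14, 43], [0, 1, 15, 20], [0, 1, 16, 30], [0, 1, 18, 23], [0, 1, 19, 36],
     [0, 1, 24, 32], [0, 1, 25, 27], [0, 1, 26, 45], [0, 1, 28, 31], [0, 1, 29, 44],
     [0, 1, 33, 34], [0, 1, 42, 46], [0, 2, 12, 14], [0, 2, 25, 37], [0, 2, 29, 43],
     [0, 3, 12, 25], [0, 3, 15, 27], [0, 4, 16, 42], [0, 4, 24, 39], [0, 4, 25, 33],
     [0, 4, 28, 38], [0, 4, 29, 41], [0, 12, 21, 38], [0, 12, 28, 37], [0, 12, 31, 45],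
     [0, 12, 35, 44], [0, 13, 25, 36], [0, 14, 39, 40], [0, 14, 42, 44], [0, 15, 16, 43],
     [0, 15, 36, 40], [0, 16, 38, 41], [0, 25, 39, 46]]),
   (12, 3, 1, [[12, 15, 27, 31], [0, 2, 4, 46], [0, 2, 6, 19], [0, 2, 8, 17], [0, 2, 15, 45],
     [0, 2, 24, 31], [0, 2, 40, 41], [0, 3, 14, 23], [12, 15, 25, 35], [0, 3, 26, 30],
     [0, 3, 36, 38], [0, 3, 37, 46], [0, 3, 39, 44], [0, 3, 41, 43], [0, 3, 42, 45],
     [0, 4, 13, 44], [0, 4, 19, 45], [0, 14, 17, 20], [0, 16, 22, 23], [0, 6, 36, 37],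
     [0, 6, 40, 43], [24, 34, 37, 42], [24, 34, 36, 41], [0, 23, 36, 39], [12, 15, 38, 46],
     [12, 15, 36, 45], [12, 15, 43, 44]]),
   (12, 1, 1, [[0, 12, 33, 40], [0, 18, 26, 41], [0, 14, 24, 41], [0, 20, 31, 40],
     [0, 16, 35, 40], [0, 22, 28, 41]]),
   (6, 3, 1, [[0, 1, 6, 7], [0, 6, 12, 18], [0, 6, 44, 45], [0, 17, 44, 46]]),
   (3, 3, 2, [[24, 27, 30, 33], [24, 25, 27, 28], [24, 27, 45, 46]]),
   (3, 3, 1, [[0, 3, 6, 9], [24, 27, 31, 34]])]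

/-- The orbits of blocks under the three automorphisms. -/
def orbits : List (List (List ℕ)) :=
  baseBlocks.flatMap fun (l, m, n, bs) => bs.map (images l m n)

/-- The blocks of the design, whose hole is `{36, …, 46}`. -/
def blocks : List (List ℕ) := orbits.flatten

/-- The first three powers of `i` modulo 47, as digits to base 256. -/
def weight (i : ℕ) : ℕ := i + 2 ^ 8 * (i ^ 2 % 47) + 2 ^ 16 * (i ^ 3 % 47)

/-- The power sums modulo 47 of a triple whose weights have the sum `s`, as digits to base 47. -/
def tripleCode (s : ℕ) : ℕ :=
  s % 2 ^ 8 % 47 + 47 * (s / 2 ^ 8 % 2 ^ 8 % 47) + 47 ^ 2 * (s / 2 ^ 16 % 47)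

/-- The number whose binary expansion has its ones at the codes of the triples in `b`. -/
def mask (b : List ℕ) : ℕ :=
  (b.map fun i => 2 ^ tripleCode ((b.map weight).sum - weight i)).foldr (· ||| ·) 0

/-- The entries of `b` are four distinct points, at most two of them in the hole. -/
def IsValid (b : List ℕ) : Prop :=
  b.length = 4 ∧ b.Nodup ∧ (∀ i ∈ b, i < 47) ∧ b.countP (36 ≤ ·) ≤ 2

instance : DecidablePred IsValid := fun _ => inferInstanceAs (Decidable (_ ∧ _))

/-- The set of points listed in `b`. -/
def pointSet (b : List ℕ) : Finset (Fin 47) := {x | x.val ∈ b}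

theorem length_blocks : blocks.length = 3924 := by
  rw [blocks, List.length_flatten]
  decide +kernel

theorem isValid_of_mem_blocks {b : List ℕ} (hb : b ∈ blocks) : IsValid b := by
  have h : orbits.all (·.all IsValid) = true := by decide +kernel
  obtain ⟨o, ho, hbo⟩ := List.mem_flatten.1 hb
  simpa using List.all_eq_true.1 (List.all_eq_true.1 h o ho) b hbo

theorem testBit_foldr_or (l : List ℕ) (c : ℕ) :
    (l.foldr (· ||| ·) 0).testBit c = l.any (·.testBit c) := by
  induction l with
  | nil => simp
  | cons a l ih => simp [ih]

theorem foldr_or_flatten (L : List (List ℕ)) :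
    L.flatten.foldr (· ||| ·) 0 = (L.map (·.foldr (· ||| ·) 0)).foldr (· ||| ·) 0 := by
  refine Nat.eq_of_testBit_eq fun i => ?_
  simp [testBit_foldr_or, List.any_flatten, Function.comp_def]

theorem foldr_or_mask_blocks :
    (blocks.map mask).foldr (· ||| ·) 0 = (blocks.map mask).sum := by
  rw [blocks, List.map_flatten, foldr_or_flatten, List.sum_flatten]
  decide +kernel

theorem or_add_and (a b : ℕ) : (a ||| b) + (a &&& b) = a + b := by
  induction a using Nat.strong_induction_on generalizing b with
  | _ a ih =>
    obtain rfl | ha := a.eq_zero_or_pos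
    · simp
    have h := ih (a / 2) (by omega) (b / 2)
    rw [← Nat.or_div_two, ← Nat.and_div_two] at h
    have h₁ : (a ||| b) % 2 = 1 ↔ _ := Nat.or_mod_two_eq_one
    have h₂ : (a &&& b) % 2 = 1 ↔ _ := Nat.and_mod_two_eq_one
    omega

theorem foldr_or_le_sum (l : List ℕ) : l.foldr (· ||| ·) 0 ≤ l.sum := by
  induction l with
  | nil => simp
  | cons a l ih =>
    simp only [List.foldr_cons, List.sum_cons]
    have := or_add_and a (l.foldr (· ||| ·) 0)
    omega

/-- Numbers whose bitwise disjunction equals their sum have no ones in common. -/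
theorem pairwise_and_eq_zero {l : List ℕ} (h : l.foldr (· ||| ·) 0 = l.sum) :
    l.Pairwise fun a b => a &&& b = 0 := by
  induction l with
  | nil => simp
  | cons a l ih =>
    simp only [List.foldr_cons, List.sum_cons] at h
    have h₁ := or_add_and a (l.foldr (· ||| ·) 0)
    have h₂ := foldr_or_le_sum l
    refine List.pairwise_cons.2 ⟨fun b hb => Nat.eq_of_testBit_eq fun i => ?_, ih (by omega)⟩
    have h₃ : a &&& l.foldr (· ||| ·) 0 = 0 := by omega
    have h₄ := congrArg (·.testBit i) h₃
    simp only [Nat.testBit_and, testBit_foldr_or, Nat.zero_testBit, Bool.and_eq_false_iff,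
      List.any_eq_false] at h₄ ⊢
    exact h₄.imp_right fun h => by simpa using h b hb

theorem map_valEmbedding_pointSet {b : List ℕ} (hb : IsValid b) :
    (pointSet b).map Fin.valEmbedding = b.toFinset := by
  ext i
  simp only [pointSet, Finset.mem_map, Finset.mem_filter_univ, Fin.valEmbedding_apply,
    List.mem_toFinset]
  exact ⟨by rintro ⟨x, hx, rfl⟩; exact hx, fun hi => ⟨⟨i, hb.2.2.1 i hi⟩, hi, rfl⟩⟩

theorem card_pointSet {b : List ℕ} (hb : IsValid b) : (pointSet b).card = 4 := by
  rw [← Finset.card_map Fin.valEmbedding, map_valEmbedding_pointSet hb,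
    List.toFinset_card_of_nodup hb.2.1, hb.1]

theorem sum_weight_pointSet {b : List ℕ} (hb : IsValid b) :
    ∑ x ∈ pointSet b, weight x.val = (b.map weight).sum := by
  rw [← List.sum_toFinset _ hb.2.1, ← map_valEmbedding_pointSet hb, Finset.sum_map]
  rfl

theorem card_le_two_of_subset_pointSet {b : List ℕ} (hb : IsValid b) {t : Finset (Fin 47)}
    (ht : ∀ x ∈ t, 36 ≤ x.val) (htb : t ⊆ pointSet b) : t.card ≤ 2 := by
  refine le_trans ?_ hb.2.2.2
  rw [List.countP_eq_length_filter, ← List.toFinset_card_of_nodup (hb.2.1.filter _),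
    ← Finset.card_map Fin.valEmbedding]
  refine Finset.card_le_card fun i hi => ?_
  obtain ⟨x, hx, rfl⟩ := Finset.mem_map.1 hi
  have hxb := htb hx
  simp only [pointSet, Finset.mem_filter_univ] at hxb
  simpa using ⟨hxb, ht x hx⟩

theorem testBit_mask {b : List ℕ} (hb : IsValid b) {t : Finset (Fin 47)} (ht : t.card = 3)
    (htb : t ⊆ pointSet b) : (mask b).testBit (tripleCode (∑ x ∈ t, weight x.val)) := by
  obtain ⟨y, hy⟩ : ∃ y, pointSet b \ t = {y} := by
    rw [← Finset.card_eq_one, Finset.card_sdiff_of_subset htb, card_pointSet hb, ht]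
  have hyb : y.val ∈ b := by
    have : y ∈ pointSet b := (Finset.mem_sdiff.1 (hy ▸ Finset.mem_singleton_self y)).1
    simpa [pointSet] using this
  have hsum := Finset.sum_sdiff htb (f := fun x => weight x.val)
  rw [hy, Finset.sum_singleton, sum_weight_pointSet hb] at hsum
  rw [mask, testBit_foldr_or, List.any_map, List.any_eq_true]
  refine ⟨y, hyb, ?_⟩
  simp [← hsum]

/-- Different members of `blocks` have no triple in common. -/
theorem pairwise_map_pointSet : (blocks.map pointSet).Pairwise fun b b' =>
    ∀ t : Finset (Fin 47), t.card = 3 → t ⊆ b → ¬ t ⊆ b' := by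
  have h := List.pairwise_map.1 (pairwise_and_eq_zero foldr_or_mask_blocks)
  refine List.pairwise_map.2 (h.imp_of_mem fun {b b'} hb hb' h t ht htb htb' => ?_)
  have h₁ := testBit_mask (isValid_of_mem_blocks hb) ht htb
  have h₂ := testBit_mask (isValid_of_mem_blocks hb') ht htb'
  have h₃ := congrArg (·.testBit (tripleCode (∑ x ∈ t, weight x.val))) h
  simp [h₁, h₂] at h₃

theorem eq_of_subset {b b' t : Finset (Fin 47)} (hb : b ∈ blocks.map pointSet)
    (hb' : b' ∈ blocks.map pointSet) (ht : t.card = 3) (htb : t ⊆ b) (htb' : t ⊆ b') :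
    b = b' := by
  let R (b b' : Finset (Fin 47)) : Prop := ∀ t : Finset (Fin 47), t.card = 3 → t ⊆ b → ¬ t ⊆ b'
  have : Std.Symm R := ⟨fun _ _ h t ht h₁ h₂ => h t ht h₂ h₁⟩
  have hR : (blocks.map pointSet).Pairwise R := pairwise_map_pointSet
  by_contra hne
  exact hR.forall hb hb' hne t ht htb htb'

theorem nodup_map_pointSet : (blocks.map pointSet).Nodup := by
  refine pairwise_map_pointSet.imp_of_mem fun {b b'} hb _ h hbb' => ?_
  obtain ⟨l, hl, rfl⟩ := List.mem_map.1 hb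
  obtain ⟨t, htb, ht⟩ := Finset.exists_subset_card_eq
    (show 3 ≤ (pointSet l).card by rw [card_pointSet (isValid_of_mem_blocks hl)]; decide)
  exact h t ht htb (hbb' ▸ htb)

end HPQS

/-- There exists an HPQS(47,11) with exactly J(47,4,4) - J(11,4,4) = 3924
blocks. -/
theorem exists_HPQS_47_11 :
    ExistsHPQS 47 11 (johnsonBound 47 - johnsonBound 11) ∧
    johnsonBound 47 - johnsonBound 11 = 3924 := by
  have hJ : johnsonBound 47 - johnsonBound 11 = 3924 := by decide
  refine ⟨⟨(HPQS.blocks.map HPQS.pointSet).toFinset, Finset.univ.filter fun x => 36 ≤ x.val,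
    ⟨?_, ?_⟩, by decide, ?_, ?_⟩, hJ⟩
  · intro b hb
    obtain ⟨l, hl, rfl⟩ := List.mem_map.1 (List.mem_toFinset.1 hb)
    exact HPQS.card_pointSet (HPQS.isValid_of_mem_blocks hl)
  · intro t ht
    refine Finset.card_le_one.2 fun b hb b' hb' => ?_
    rw [Finset.mem_filter, List.mem_toFinset] at hb hb'
    exact HPQS.eq_of_subset hb.1 hb'.1 ht hb.2 hb'.2
  · intro t htY ht b hb htb
    obtain ⟨l, hl, rfl⟩ := List.mem_map.1 (List.mem_toFinset.1 hb)
    have := HPQS.card_le_two_of_subset_pointSet (HPQS.isValid_of_mem_blocks hl)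
      (fun x hx => by simpa using htY hx) htb
    omega
  · rw [List.toFinset_card_of_nodup HPQS.nodup_map_pointSet, List.length_map,
      HPQS.length_blocks, hJ]
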